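/- arXiv:2012.02661 — 4 statements merged into one kernel-verified Lean document; each statement's English description precedes it below -/
import Mathlib

section
/- Let k ≥ 2, n ≥ 1, A ∈ ℝ^{n×n}, H ∈ ℝ^{n×k}, and let C ∈ ℝ^{(k+n)×(k+n)} be the block matrix with top-left k×k block 0, top-right block (1/2)H^T, bottom-left block (1/2)H, and bottom-right block A. Fix simplex vertices r_1,…,r_k ∈ ℝ^{k+n}. Let Y ∈ ℝ^{(k+n)×(k+n)} be any positive semidefinite matrix with Y_{ii} = 1 for all i ∈ [k+n] and Y_{ij} = −1/(k−1) for all 1 ≤ i < j ≤ k. Then there exist unit vectors v_1,…,v_n ∈ ℝ^{k+n} such that Y · C = Σ_{i=1}^n Σ_{j=1}^n A_{ij} v_i · v_j + Σ_{i=1}^n Σ_{l=1}^k H_{il} v_i · r_l. -/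
open Matrix

/-- Two finite families with equal Gram matrices differ by a linear isometry. -/
theorem exists_linearIsometry_of_inner_eq {ι V : Type*} [Fintype ι]
    [NormedAddCommGroup V] [InnerProductSpace ℝ V] [FiniteDimensional ℝ V]
    (u w : ι → V) (h : ∀ i j, inner ℝ (u i) (u j) = inner ℝ (w i) (w j)) :
    ∃ L : V →ₗᵢ[ℝ] V, ∀ i, L (u i) = w i := by
  classical
  let T : (ι → ℝ) →ₗ[ℝ] V := Fintype.linearCombination ℝ u
  let R : (ι → ℝ) →ₗ[ℝ] V := Fintype.linearCombination ℝ w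
  have hnorm : ∀ c, ‖R c‖ = ‖T c‖ := by
    intro c
    have hinner : inner ℝ (R c) (R c) = inner ℝ (T c) (T c) := by
      simp only [T, R, Fintype.linearCombination_apply, sum_inner, inner_sum,
        inner_smul_left, inner_smul_right, h]
    rw [real_inner_self_eq_norm_sq, real_inner_self_eq_norm_sq] at hinner
    exact (sq_eq_sq₀ (norm_nonneg _) (norm_nonneg _)).mp hinner
  obtain ⟨g, hg⟩ := T.rangeRestrict.exists_rightInverse_of_surjective T.range_rangeRestrict
  have hTg : ∀ x, T (g x) = x := fun x => congrArg Subtype.val (LinearMap.congr_fun hg x)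
  let f : LinearMap.range T →ₗᵢ[ℝ] V :=
    { toLinearMap := R ∘ₗ g
      norm_map' := fun x => by
        rw [LinearMap.comp_apply, hnorm, hTg, Submodule.coe_norm] }
  refine ⟨f.extend, fun i => ?_⟩
  have hT : T (Pi.single i 1) = u i := by
    simp [T, Fintype.linearCombination_apply_single]
  have hR : R (Pi.single i 1) = w i := by
    simp [R, Fintype.linearCombination_apply_single]
  let x : LinearMap.range T := ⟨u i, Pi.single i 1, hT⟩
  have hfx : f x = w i := by
    rw [← sub_eq_zero, ← norm_eq_zero]
    change ‖R (g x) - w i‖ = 0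
    rw [← hR, ← map_sub, hnorm, map_sub, hTg, hT, sub_self, norm_zero]
  exact (f.extend_apply x).trans hfx

open scoped MatrixOrder in
/-- A real positive semidefinite matrix is the Gram matrix of vectors in a Euclidean space of
the same dimension. -/
theorem Matrix.PosSemidef.exists_inner_eq {m m' : Type*} [Fintype m] [Fintype m']
    (e : m ≃ m') {Y : Matrix m m ℝ} (hY : Y.PosSemidef) :
    ∃ u : m → EuclideanSpace ℝ m', ∀ p q, inner ℝ (u p) (u q) = Y p q := by
  classical
  obtain ⟨B, rfl⟩ := CStarAlgebra.nonneg_iff_eq_star_mul_self.mp hY.nonneg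
  refine ⟨fun p => WithLp.toLp 2 fun a => B (e.symm a) p, fun p q => ?_⟩
  simp only [PiLp.inner_apply, Matrix.mul_apply, Matrix.star_apply]
  rw [← e.sum_comp]
  simp [mul_comm]

/-- **Rounding direction of the SDP equivalence (Appendix A, second half).**
For any positive semidefinite `Y ∈ ℝ^{(k+n)×(k+n)}` with unit diagonal and
entries `−1/(k−1)` in the top-left `k×k` block above the diagonal, and fixed
simplex vertices `r₁,…,r_k ∈ ℝ^{k+n}`, there exist unit vectors
`v₁,…,vₙ ∈ ℝ^{k+n}` with
`Y·C = Σᵢⱼ Aᵢⱼ vᵢ·vⱼ + Σᵢₗ Hᵢₗ vᵢ·r_l`, where `C = [[0, ½Hᵀ],[½H, A]]`. -/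
theorem feasible_Y_realized_by_unit_vectors
    (k n : ℕ) (hk : 2 ≤ k) (hn : 1 ≤ n)
    (A : Matrix (Fin n) (Fin n) ℝ) (H : Matrix (Fin n) (Fin k) ℝ)
    (C : Matrix (Fin k ⊕ Fin n) (Fin k ⊕ Fin n) ℝ)
    (hC : C = Matrix.fromBlocks 0 ((1 / 2 : ℝ) • Hᵀ) ((1 / 2 : ℝ) • H) A)
    (r : Fin k → (Fin (k + n) → ℝ))
    (hr : ∀ l l' : Fin k,
      r l ⬝ᵥ r l' = if l = l' then (1 : ℝ) else -(1 / ((k : ℝ) - 1)))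
    (Y : Matrix (Fin k ⊕ Fin n) (Fin k ⊕ Fin n) ℝ)
    (hYpsd : Y.PosSemidef)
    (hYdiag : ∀ p : Fin k ⊕ Fin n, Y p p = 1)
    (hYtop : ∀ i j : Fin k, i < j → Y (Sum.inl i) (Sum.inl j) = -(1 / ((k : ℝ) - 1))) :
    ∃ v : Fin n → (Fin (k + n) → ℝ),
      (∀ i : Fin n, v i ⬝ᵥ v i = 1)
      ∧ (∑ p : Fin k ⊕ Fin n, ∑ q : Fin k ⊕ Fin n, Y p q * C p q)
          = (∑ i : Fin n, ∑ j : Fin n, A i j * (v i ⬝ᵥ v j))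
            + (∑ i : Fin n, ∑ l : Fin k, H i l * (v i ⬝ᵥ r l)) := by
  obtain ⟨u, hu⟩ := hYpsd.exists_inner_eq finSumFinEquiv
  have hsymm : ∀ p q, Y p q = Y q p := fun p q => by
    rw [← hu, ← hu, real_inner_comm]
  have hdot : ∀ x y : EuclideanSpace ℝ (Fin (k + n)), x.ofLp ⬝ᵥ y.ofLp = inner ℝ x y :=
    fun x y => by simp [PiLp.inner_apply, dotProduct, mul_comm]
  obtain ⟨L, hL⟩ := exists_linearIsometry_of_inner_eq (fun l => u (Sum.inl l))
    (fun l => WithLp.toLp 2 (r l)) (fun l l' => by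
      rw [hu, ← hdot, hr]
      split_ifs with hll
      · rw [hll, hYdiag]
      · rcases lt_or_gt_of_ne hll with hlt | hlt
        · exact hYtop l l' hlt
        · rw [hsymm, hYtop l' l hlt])
  have hvv : ∀ i j, (L (u (Sum.inr i))).ofLp ⬝ᵥ (L (u (Sum.inr j))).ofLp
      = Y (Sum.inr i) (Sum.inr j) := fun i j => by
    rw [hdot, L.inner_map_map, hu]
  have hvr : ∀ i l, (L (u (Sum.inr i))).ofLp ⬝ᵥ r l = Y (Sum.inr i) (Sum.inl l) := fun i l => by
    rw [← hu, ← L.inner_map_map, hL, ← hdot]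
  refine ⟨fun i => (L (u (Sum.inr i))).ofLp, fun i => by rw [hvv, hYdiag], ?_⟩
  have hcross : ∑ l, ∑ i, Y (Sum.inl l) (Sum.inr i) * (1 / 2 * H i l)
      = ∑ i, ∑ l, Y (Sum.inr i) (Sum.inl l) * (1 / 2 * H i l) := by
    rw [Finset.sum_comm]
    simp only [hsymm (Sum.inl _) (Sum.inr _)]
  simp only [hvv, hvr, hC, Fintype.sum_sum_type, Matrix.fromBlocks_apply₁₁,
    Matrix.fromBlocks_apply₁₂, Matrix.fromBlocks_apply₂₁, Matrix.fromBlocks_apply₂₂,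
    Matrix.zero_apply, Matrix.smul_apply, Matrix.transpose_apply, smul_eq_mul, mul_zero,
    Finset.sum_const_zero, zero_add, Finset.sum_add_distrib, hcross]
  rw [← add_assoc, add_comm]
  congr 1
  · simp only [mul_comm]
  · simp only [← Finset.sum_add_distrib]
    exact Finset.sum_congr rfl fun i _ => Finset.sum_congr rfl fun l _ => by ring
end

section
/- Let k ≥ 2, m ≥ 1, d = mk, and let C̃ = (k/(k−1))·(I_d − (1/k)(1_{k×k} ⊗ I_m)) ∈ ℝ^{d×d}. If z, w ∈ ℝ^d are both feasible (z, w ≥ 0 entrywise, ‖Σ_b z^b‖₂² = ‖Σ_b w^b‖₂² = 1), then z^T C̃ w ≥ −1/(k−1). -/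
open Matrix
open scoped Kronecker

/-- The matrix `C̃ = (k/(k−1))·(I_d − (1/k)(1_{k×k} ⊗ I_m))` of the `M⁴+`
relaxation, with `ℝ^{mk}` indexed by block `b ∈ [k]` and in-block index
`j ∈ [m]`. -/
noncomputable def simplexQuadMatrix (k m : ℕ) :
    Matrix (Fin k × Fin m) (Fin k × Fin m) ℝ :=
  ((k : ℝ) / ((k : ℝ) - 1)) •
    ((1 : Matrix (Fin k × Fin m) (Fin k × Fin m) ℝ) -
      ((1 : ℝ) / (k : ℝ)) •
        ((Matrix.of fun _ _ : Fin k => (1 : ℝ)) ⊗ₖ (1 : Matrix (Fin m) (Fin m) ℝ)))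

/-- The bilinear form of `simplexQuadMatrix` in terms of the block sums. -/
theorem dotProduct_simplexQuadMatrix_mulVec (k m : ℕ) (z w : Fin k × Fin m → ℝ) :
    z ⬝ᵥ (simplexQuadMatrix k m *ᵥ w) =
      (k : ℝ) / ((k : ℝ) - 1) *
        (z ⬝ᵥ w - 1 / (k : ℝ) * ∑ j, (∑ b, z (b, j)) * ∑ b, w (b, j)) := by
  have hblock : z ⬝ᵥ (((Matrix.of fun _ _ : Fin k => (1 : ℝ)) ⊗ₖ
      (1 : Matrix (Fin m) (Fin m) ℝ)) *ᵥ w) = ∑ j, (∑ b, z (b, j)) * ∑ b, w (b, j) := by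
    simp only [dotProduct, mulVec, kroneckerMap_apply, of_apply, one_mul, one_apply, ite_mul,
      zero_mul, Fintype.sum_prod_type, Finset.sum_ite_eq, Finset.mem_univ, if_true]
    rw [Finset.sum_comm]
    simp only [Finset.sum_mul]
  rw [simplexQuadMatrix, smul_mulVec, sub_mulVec, smul_mulVec, one_mulVec, dotProduct_smul,
    dotProduct_sub, dotProduct_smul, hblock, smul_eq_mul, smul_eq_mul]

/-- **Lower pairwise bound (Appendix B).**  If `z, w ∈ ℝ^{mk}` are both
feasible (entrywise nonnegative with `‖Σ_b z^b‖₂² = ‖Σ_b w^b‖₂² = 1`), then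
`zᵀ C̃ w ≥ −1/(k−1)`. -/
theorem simplexQuadMatrix_pairwise_lower_bound
    (k m : ℕ) (hk : 2 ≤ k) (hm : 1 ≤ m)
    (z w : Fin k × Fin m → ℝ)
    (hz0 : ∀ p : Fin k × Fin m, 0 ≤ z p)
    (hz1 : ∑ j : Fin m, (∑ b : Fin k, z (b, j)) ^ 2 = 1)
    (hw0 : ∀ p : Fin k × Fin m, 0 ≤ w p)
    (hw1 : ∑ j : Fin m, (∑ b : Fin k, w (b, j)) ^ 2 = 1) :
    -(1 / ((k : ℝ) - 1)) ≤ z ⬝ᵥ (simplexQuadMatrix k m *ᵥ w) := by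
  have hk2 : (2 : ℝ) ≤ k := by exact_mod_cast hk
  have hk1 : (0 : ℝ) < (k : ℝ) - 1 := by linarith
  have hk0 : (k : ℝ) ≠ 0 := by linarith
  have hdot : 0 ≤ z ⬝ᵥ w := dotProduct_nonneg_of_nonneg hz0 hw0
  have hsum : ∑ j, (∑ b, z (b, j)) * ∑ b, w (b, j) ≤ 1 := by
    have hcs := Finset.sum_mul_sq_le_sq_mul_sq Finset.univ
      (fun j => ∑ b, z (b, j)) (fun j => ∑ b, w (b, j))
    rw [hz1, hw1, one_mul] at hcs
    exact (abs_le_one_iff_mul_self_le_one.2 (by rwa [← sq])) |> le_of_abs_le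
  rw [dotProduct_simplexQuadMatrix_mulVec]
  calc -(1 / ((k : ℝ) - 1)) = (k : ℝ) / ((k : ℝ) - 1) * (0 - 1 / (k : ℝ) * 1) := by
        field_simp
        ring
    _ ≤ _ := by gcongr
end

section
/- Let k ≥ 2, m ≥ 1, and g ∈ ℝ^{mk}. Define λ = sqrt( Σ_{j=1}^m ( max_{b∈[k]} g^b_j )₊² ), where (x)₊ = max(x,0). Then for every z ∈ ℝ^{mk} with z ≥ 0 entrywise and ‖Σ_{b=1}^k z^b‖₂² = 1, we have g^T z ≤ λ. -/
/-- **KKT upper bound for the `M⁴+` block update (Appendix B).**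
For `g ∈ ℝ^{mk}` let `λ = √(Σⱼ (max_b g^b_j)₊²)`.  Then every feasible `z`
(entrywise nonnegative with `‖Σ_b z^b‖₂² = 1`) satisfies `gᵀz ≤ λ`. -/
theorem block_update_upper_bound
    (k m : ℕ) (hk : 2 ≤ k) (hm : 1 ≤ m)
    (g : Fin k × Fin m → ℝ)
    (lam : ℝ)
    (hlam : lam = Real.sqrt (∑ j : Fin m,
      (max (Finset.univ.sup' ⟨⟨0, by omega⟩, Finset.mem_univ _⟩
        (fun b : Fin k => g (b, j))) 0) ^ 2))
    (z : Fin k × Fin m → ℝ)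
    (hz0 : ∀ p : Fin k × Fin m, 0 ≤ z p)
    (hz1 : ∑ j : Fin m, (∑ b : Fin k, z (b, j)) ^ 2 = 1) :
    (∑ p : Fin k × Fin m, g p * z p) ≤ lam := by
  subst hlam
  set c : Fin m → ℝ := fun j =>
    max (Finset.univ.sup' ⟨⟨0, by omega⟩, Finset.mem_univ _⟩ (fun b : Fin k => g (b, j))) 0
  have hgc : ∀ b j, g (b, j) ≤ c j := fun b j =>
    (Finset.le_sup' (fun b : Fin k => g (b, j)) (Finset.mem_univ b)).trans (le_max_left _ _)
  calc ∑ p : Fin k × Fin m, g p * z p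
      = ∑ j, ∑ b, g (b, j) * z (b, j) := Fintype.sum_prod_type_right _
    _ ≤ ∑ j, c j * ∑ b, z (b, j) := by
        refine Finset.sum_le_sum fun j _ => ?_
        rw [Finset.mul_sum]
        exact Finset.sum_le_sum fun b _ => mul_le_mul_of_nonneg_right (hgc b j) (hz0 _)
    _ ≤ √(∑ j, c j ^ 2) * √(∑ j, (∑ b, z (b, j)) ^ 2) :=
        Real.sum_mul_le_sqrt_mul_sqrt _ _ _
    _ = √(∑ j, c j ^ 2) := by rw [hz1, Real.sqrt_one, mul_one]
end

section
/- Let k ≥ 2, m ≥ 1, and g ∈ ℝ^{mk}. Define λ = sqrt( Σ_{j=1}^m ( max_{b∈[k]} g^b_j )₊² ) and assume λ > 0. For each j ∈ [m] choose b(j) ∈ argmax_b g^b_j, and define z ∈ ℝ^{mk} by z^{b(j)}_j = (g^{b(j)}_j)₊ / λ and z^b_j = 0 for b ≠ b(j). Then z is feasible (z ≥ 0 entrywise and ‖Σ_{b=1}^k z^b‖₂² = 1) and g^T z = λ; hence z attains the maximum of g^T z' over all feasible z', and this maximum equals λ. -/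
/-- **Optimality of the `M⁴+` block update (Appendix B).**
For `g ∈ ℝ^{mk}` let `λ = √(Σⱼ (max_b g^b_j)₊²)` and assume `λ > 0`.  Choose
for each `j ∈ [m]` an argmax block `b(j)` and define `z` by
`z^{b(j)}_j = (g^{b(j)}_j)₊ / λ` and `z^b_j = 0` for `b ≠ b(j)`.  Then `z` is
feasible (entrywise nonnegative with `‖Σ_b z^b‖₂² = 1`), `gᵀz = λ`, and `z`
maximizes `gᵀz'` over all feasible `z'`; the maximum equals `λ`. -/
theorem block_update_optimal
    (k m : ℕ) (hk : 2 ≤ k) (hm : 1 ≤ m)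
    (g : Fin k × Fin m → ℝ)
    (lam : ℝ)
    (hlam : lam = Real.sqrt (∑ j : Fin m,
      (max (Finset.univ.sup' ⟨⟨0, by omega⟩, Finset.mem_univ _⟩
        (fun b : Fin k => g (b, j))) 0) ^ 2))
    (hlampos : 0 < lam)
    (bsel : Fin m → Fin k)
    (hbsel : ∀ (j : Fin m) (b : Fin k), g (b, j) ≤ g (bsel j, j))
    (z : Fin k × Fin m → ℝ)
    (hz : ∀ p : Fin k × Fin m,
      z p = if p.1 = bsel p.2 then max (g (bsel p.2, p.2)) 0 / lam else 0) :
    ((∀ p : Fin k × Fin m, 0 ≤ z p)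
      ∧ ∑ j : Fin m, (∑ b : Fin k, z (b, j)) ^ 2 = 1)
    ∧ (∑ p : Fin k × Fin m, g p * z p) = lam
    ∧ (∀ z' : Fin k × Fin m → ℝ,
        (∀ p : Fin k × Fin m, 0 ≤ z' p) →
        (∑ j : Fin m, (∑ b : Fin k, z' (b, j)) ^ 2 = 1) →
          (∑ p : Fin k × Fin m, g p * z' p) ≤ ∑ p : Fin k × Fin m, g p * z p) := by
  set c : Fin m → ℝ := fun j => max (g (bsel j, j)) 0 with hc
  have hsup : ∀ j : Fin m, Finset.univ.sup' ⟨⟨0, by omega⟩, Finset.mem_univ _⟩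
      (fun b : Fin k => g (b, j)) = g (bsel j, j) := fun j =>
    le_antisymm (Finset.sup'_le _ _ fun b _ => hbsel j b)
      (Finset.le_sup' (fun b : Fin k => g (b, j)) (Finset.mem_univ (bsel j)))
  have hsq : ∑ j, c j ^ 2 = lam ^ 2 := by
    rw [hlam, Real.sq_sqrt (Finset.sum_nonneg fun j _ => sq_nonneg _)]
    simp only [hsup, hc]
  have hc0 : ∀ j, 0 ≤ c j := fun j => le_max_right _ _
  have hblock : ∀ j, ∑ b, z (b, j) = c j / lam := fun j => by simp [hz, hc]
  have hmul : ∀ j, g (bsel j, j) * c j = c j ^ 2 := fun j => by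
    rcases le_total (g (bsel j, j)) 0 with h | h <;> simp [hc, h, sq]
  have hval : ∑ p, g p * z p = lam := by
    calc ∑ p, g p * z p = ∑ j, c j ^ 2 / lam := by
          rw [Fintype.sum_prod_type_right]
          refine Finset.sum_congr rfl fun j _ => ?_
          rw [← hmul j]
          simp [hz, hc, mul_div_assoc]
      _ = lam := by
          rw [← Finset.sum_div, hsq]
          field_simp
  refine ⟨⟨fun p => ?_, ?_⟩, hval, fun z' hz' hnorm => ?_⟩
  · rw [hz]
    split_ifs
    · exact div_nonneg (hc0 p.2) hlampos.le
    · exact le_rfl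
  · simp only [hblock, div_pow]
    rw [← Finset.sum_div, hsq, div_self (pow_ne_zero 2 hlampos.ne')]
  · rw [hval]
    calc ∑ p, g p * z' p ≤ ∑ j, c j * ∑ b, z' (b, j) := by
          rw [Fintype.sum_prod_type_right]
          refine Finset.sum_le_sum fun j _ => ?_
          rw [Finset.mul_sum]
          exact Finset.sum_le_sum fun b _ => mul_le_mul_of_nonneg_right
            ((hbsel j b).trans (le_max_left _ _)) (hz' _)
      _ ≤ √(∑ j, c j ^ 2) * √(∑ j, (∑ b, z' (b, j)) ^ 2) :=
          Real.sum_mul_le_sqrt_mul_sqrt _ _ _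
      _ = lam := by
          rw [hnorm, hsq, Real.sqrt_sq hlampos.le, Real.sqrt_one, mul_one]
end
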